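/- Let F be a field of characteristic different from 2 and let A be an involutive F-algebra. Then A is von-Neumann finite if and only if every 3-dimensional subalgebra of A is either commutative or isomorphic as an F-algebra to the algebra U of upper triangular 2×2 matrices over F. -/

import Mathlib

section NonAssocAlgebra

variable {F A : Type*} [Field F] [NonAssocRing A] [Module F A]
  [SMulCommClass F A A] [IsScalarTower F A A]

theorem linearIndependent_one_pair_of_not_commute {x y : A} (h : x * y ≠ y * x) :
    LinearIndependent F ![(1 : A), x, y] := by
  have hsub : x * y - y * x ≠ 0 := sub_ne_zero.mpr h
  have h1 : (1 : A) ≠ 0 := fun h0 => h <| by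
    rw [← one_mul (x * y), ← one_mul (y * x), h0, zero_mul, zero_mul]
  rw [Fintype.linearIndependent_iff]
  intro c hc
  simp only [Fin.sum_univ_three, Matrix.cons_val] at hc
  have hcx : c 2 • (x * y - y * x) = 0 := by
    have := congrArg (fun a => x * a - a * x) hc
    simp only [mul_add, add_mul, mul_smul_comm, smul_mul_assoc, mul_one, one_mul, mul_zero,
      zero_mul, sub_zero] at this
    rw [← this]
    module
  have hcy : c 1 • (x * y - y * x) = 0 := by
    have := congrArg (fun a => a * y - y * a) hc
    simp only [mul_add, add_mul, mul_smul_comm, smul_mul_assoc, mul_one, one_mul, mul_zero,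
      zero_mul, sub_zero] at this
    rw [← this]
    module
  have hc2 : c 2 = 0 := (smul_eq_zero.mp hcx).resolve_right hsub
  have hc1 : c 1 = 0 := (smul_eq_zero.mp hcy).resolve_right hsub
  have hc0 : c 0 = 0 := (smul_eq_zero.mp (by simpa [hc1, hc2] using hc)).resolve_right h1
  intro i
  fin_cases i <;> assumption

/-- In a three-dimensional unital subalgebra, `1` and two noncommuting elements form a basis. -/
theorem exists_basis_of_not_commute {B : Submodule F A} (hone : (1 : A) ∈ B)
    (hB : Module.finrank F B = 3) {x y : A} (hx : x ∈ B) (hy : y ∈ B) (h : x * y ≠ y * x) :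
    ∃ b : Module.Basis (Fin 3) F B, (b 0 : A) = 1 ∧ (b 1 : A) = x ∧ (b 2 : A) = y := by
  have hli : LinearIndependent F ![(⟨1, hone⟩ : B), ⟨x, hx⟩, ⟨y, hy⟩] := by
    refine LinearIndependent.of_comp B.subtype ?_
    convert linearIndependent_one_pair_of_not_commute (F := F) h using 1
    ext i
    fin_cases i <;> rfl
  refine ⟨basisOfLinearIndependentOfCardEqFinrank hli (by simp [hB]), ?_, ?_, ?_⟩ <;> simp

/-- The algebra with basis `1, z, w` and relations `z² = 1`, `zw = w = -wz`, `w² = 0` is the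
algebra of upper triangular matrices. -/
theorem exists_iso_upperTriangular {B : Submodule F A} (hchar : (2 : F) ≠ 0) (hone : (1 : A) ∈ B)
    (hmul : ∀ x ∈ B, ∀ y ∈ B, x * y ∈ B) (b : Module.Basis (Fin 3) F B) {z w : A}
    (hb0 : (b 0 : A) = 1) (hb1 : (b 1 : A) = z) (hb2 : (b 2 : A) = w)
    (hzz : z * z = 1) (hzw : z * w = w) (hwz : w * z = -w) (hww : w * w = 0) :
    ∃ f : B →ₗ[F] Matrix (Fin 2) (Fin 2) F,
      Function.Injective f ∧
      Set.range f = {M : Matrix (Fin 2) (Fin 2) F | M 1 0 = 0} ∧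
      f ⟨1, hone⟩ = 1 ∧
      ∀ x y : B, f ⟨(x : A) * (y : A), hmul x x.2 y y.2⟩ = f x * f y := by
  have hcoe : ∀ c : Fin 3 → F,
      ((b.equivFun.symm c : B) : A) = c 0 • (1 : A) + c 1 • z + c 2 • w := fun c => by
    simp [Module.Basis.equivFun_symm_apply, Fin.sum_univ_three, hb0, hb1, hb2]
  let g : (Fin 3 → F) →ₗ[F] Matrix (Fin 2) (Fin 2) F :=
    { toFun := fun c => !![c 0 + c 1, c 2; 0, c 0 - c 1]
      map_add' := fun c d => by
        ext i j
        fin_cases i <;> fin_cases j <;> simp <;> ring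
      map_smul' := fun r c => by
        ext i j
        fin_cases i <;> fin_cases j <;> simp <;> ring }
  have hg : ∀ c, g c = !![c 0 + c 1, c 2; 0, c 0 - c 1] := fun _ => rfl
  refine ⟨g ∘ₗ b.equivFun.toLinearMap, ?_, ?_, ?_, ?_⟩
  · rw [LinearMap.coe_comp]
    refine Function.Injective.comp ?_ b.equivFun.injective
    rw [injective_iff_map_eq_zero]
    intro c hc
    rw [hg] at hc
    have h00 : c 0 + c 1 = 0 := by simpa using congrFun (congrFun hc 0) 0
    have h01 : c 2 = 0 := by simpa using congrFun (congrFun hc 0) 1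
    have h11 : c 0 - c 1 = 0 := by simpa using congrFun (congrFun hc 1) 1
    have hc0 : c 0 = 0 := mul_left_cancel₀ hchar (by linear_combination h00 + h11)
    ext i
    fin_cases i
    · exact hc0
    · simpa [hc0] using h00
    · exact h01
  · ext M
    simp only [Set.mem_range, Set.mem_ofPred_eq]
    constructor
    · rintro ⟨x, rfl⟩
      simp [hg]
    · intro hM
      refine ⟨b.equivFun.symm ![(M 0 0 + M 1 1) / 2, (M 0 0 - M 1 1) / 2, M 0 1], ?_⟩
      rw [LinearMap.comp_apply, LinearEquiv.coe_coe, LinearEquiv.apply_symm_apply, hg]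
      ext i j
      fin_cases i <;> fin_cases j <;> simp [hM] <;> field_simp <;> ring
  · have h1 : (⟨1, hone⟩ : B) = b.equivFun.symm ![1, 0, 0] := Subtype.ext (by rw [hcoe]; simp)
    rw [h1, LinearMap.comp_apply, LinearEquiv.coe_coe, LinearEquiv.apply_symm_apply, hg]
    ext i j
    fin_cases i <;> fin_cases j <;> simp
  · intro x y
    obtain ⟨c, rfl⟩ := b.equivFun.symm.surjective x
    obtain ⟨d, rfl⟩ := b.equivFun.symm.surjective y
    have hcd : (⟨_, hmul _ (b.equivFun.symm c).2 _ (b.equivFun.symm d).2⟩ : B) =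
        b.equivFun.symm ![c 0 * d 0 + c 1 * d 1, c 0 * d 1 + c 1 * d 0,
          c 0 * d 2 + c 2 * d 0 + c 1 * d 2 - c 2 * d 1] := by
      refine Subtype.ext ?_
      simp only [hcoe, mul_add, add_mul, smul_mul_assoc, mul_smul_comm, one_mul, mul_one,
        hzz, hzw, hwz, hww]
      simp
      module
    rw [hcd]
    simp only [LinearMap.comp_apply, LinearEquiv.coe_coe, LinearEquiv.apply_symm_apply, hg]
    ext i j
    fin_cases i <;> fin_cases j <;> simp [Matrix.mul_apply, Fin.sum_univ_two] <;> ring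

/-- Von Neumann finiteness forces the structure constants of an algebra spanned by `1, z, w` with
`z² ∈ F`, `w² ∈ F`, `zw = q + w` and `wz = q - w`. -/
theorem structure_constants_of_vonNeumannFinite (hchar : (2 : F) ≠ 0)
    (hfin : ∀ a b : A, a * b = 1 → b * a = 1) {z w : A} {p q r : F} (hw : w ≠ 0)
    (hzz : z * z = p • (1 : A)) (hzw : z * w = q • (1 : A) + w)
    (hwz : w * z = q • (1 : A) - w) (hww : w * w = r • (1 : A)) :
    p = 1 ∧ q = 0 ∧ r = 0 := by
  have hr : r = 0 := by
    by_contra hr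
    have hab : w * (r⁻¹ • w + r • z - q • w + r • (1 : A)) = 1 := by
      simp only [mul_add, mul_sub, mul_smul_comm, mul_one, hwz, hww, smul_smul,
        inv_mul_cancel₀ hr]
      module
    have hba := hfin _ _ hab
    simp only [add_mul, sub_mul, smul_mul_assoc, one_mul, hzw, hww, smul_smul,
      inv_mul_cancel₀ hr] at hba
    have h0 : (2 * r) • w = 0 := by
      rw [← sub_eq_zero] at hba
      rw [← hba]
      module
    exact (smul_ne_zero (mul_ne_zero hchar hr) hw) h0
  have hq : q = 0 := by
    by_contra hq
    have hab : w * (q⁻¹ • z + q⁻¹ • (1 : A)) = 1 := by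
      simp only [mul_add, mul_smul_comm, mul_one, hwz, smul_sub, smul_smul, inv_mul_cancel₀ hq]
      module
    have hba := hfin _ _ hab
    simp only [add_mul, smul_mul_assoc, one_mul, hzw, smul_add, smul_smul,
      inv_mul_cancel₀ hq] at hba
    have h0 : (2 * q⁻¹) • w = 0 := by
      rw [← sub_eq_zero] at hba
      rw [← hba]
      module
    exact (smul_ne_zero (mul_ne_zero hchar (inv_ne_zero hq)) hw) h0
  subst hr hq
  refine ⟨?_, rfl, rfl⟩
  by_contra hp
  replace hp : p - 1 ≠ 0 := sub_ne_zero.mpr hp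
  have hsq : (p - 1)⁻¹ • (p • (1 : A) - 1) = 1 := by
    rw [show p • (1 : A) - 1 = (p - 1) • 1 by module, smul_smul, inv_mul_cancel₀ hp, one_smul]
  have hab : (z - 1) * ((p - 1)⁻¹ • (z + 1) + w) = 1 := by
    simp only [mul_add, sub_mul, smul_add, mul_smul_comm, mul_one, one_mul, hzz, hzw]
    refine Eq.trans ?_ hsq
    module
  have hba := hfin _ _ hab
  simp only [add_mul, mul_sub, smul_mul_assoc, mul_one, one_mul, hzz, hwz] at hba
  have h0 : (2 : F) • w = 0 := by
    linear_combination (norm := module) hsq - hba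
  exact (smul_ne_zero hchar hw) h0

/-- If the commutator of `x` and `y` is a nonzero combination of `x` and `y`, then the span of `x`
and `y` contains some `z` with `[z, [x, y]] = 2 [x, y]`. -/
theorem exists_commutator_eq_two_smul {W : Submodule F A} {x y : A} {α β : F} (hx : x ∈ W)
    (hy : y ∈ W) (hne : x * y - y * x ≠ 0) (hspan : x * y - y * x = α • x + β • y) :
    ∃ z ∈ W, z * (x * y - y * x) - (x * y - y * x) * z = (2 : F) • (x * y - y * x) := by
  by_cases hα : α = 0
  · have hβ : β ≠ 0 := by
      rintro rfl
      simp [hspan, hα] at hne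
    refine ⟨(2 * β⁻¹) • x, W.smul_mem _ hx, ?_⟩
    have h : x * (x * y - y * x) - (x * y - y * x) * x = β • (x * y - y * x) := by
      conv_lhs => rw [hspan]
      simp only [mul_add, add_mul, mul_smul_comm, smul_mul_assoc]
      module
    rw [smul_mul_assoc, mul_smul_comm, ← smul_sub, h, smul_smul, mul_assoc, inv_mul_cancel₀ hβ,
      mul_one]
  · refine ⟨(-2 * α⁻¹) • y, W.smul_mem _ hy, ?_⟩
    have h : y * (x * y - y * x) - (x * y - y * x) * y = (-α) • (x * y - y * x) := by
      conv_lhs => rw [hspan]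
      simp only [mul_add, add_mul, mul_smul_comm, smul_mul_assoc]
      module
    rw [smul_mul_assoc, mul_smul_comm, ← smul_sub, h, smul_smul]
    congr 1
    field_simp

/-- If every element satisfies a monic quadratic equation, then two noncommuting elements whose
product is `1` span, together with `1`, a subalgebra. -/
theorem mul_mem_span_of_mul_eq_one (hquad : ∀ a : A, ∃ t n : F, a * a = t • a + n • (1 : A))
    {a b : A} (hab : a * b = 1) :
    ∀ x ∈ Submodule.span F (Set.range ![(1 : A), a, b]),
      ∀ y ∈ Submodule.span F (Set.range ![(1 : A), a, b]),
        x * y ∈ Submodule.span F (Set.range ![(1 : A), a, b]) := by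
  set B := Submodule.span F (Set.range ![(1 : A), a, b])
  have hgen : ∀ i, ![(1 : A), a, b] i ∈ B := fun i => Submodule.subset_span ⟨i, rfl⟩
  have h1 : (1 : A) ∈ B := hgen 0
  have ha : a ∈ B := hgen 1
  have hb : b ∈ B := hgen 2
  have hsq : ∀ c ∈ B, c * c ∈ B := fun c hc => by
    obtain ⟨t, n, h⟩ := hquad c
    rw [h]
    exact B.add_mem (B.smul_mem _ hc) (B.smul_mem _ h1)
  have hba : b * a ∈ B := by
    have h : b * a = (a + b) * (a + b) - a * a - b * b - 1 := by
      rw [mul_add, add_mul, add_mul, hab]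
      abel
    rw [h]
    exact B.sub_mem (B.sub_mem (B.sub_mem (hsq _ (B.add_mem ha hb)) (hsq _ ha)) (hsq _ hb)) h1
  intro x hx y hy
  induction hx using Submodule.span_induction with
  | zero => simp
  | add u v _ _ hu hv => rw [add_mul]; exact B.add_mem hu hv
  | smul c u _ hu => rw [smul_mul_assoc]; exact B.smul_mem _ hu
  | mem u hu =>
    induction hy using Submodule.span_induction with
    | zero => simp
    | add v w _ _ hv hw => rw [mul_add]; exact B.add_mem hv hw
    | smul c v _ hv => rw [mul_smul_comm]; exact B.smul_mem _ hv
    | mem v hv =>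
      obtain ⟨i, rfl⟩ := hu
      obtain ⟨j, rfl⟩ := hv
      fin_cases i <;> fin_cases j <;> simp [h1, ha, hb, hab, hba, hsq]

/-- For an involution with scalar traces, a noncommutative three-dimensional subalgebra contains
skew elements `z` and `w ≠ 0` with `[z, w] = 2w`. -/
theorem exists_skew_pair {σ : A →ₗ[F] A} (hchar : (2 : F) ≠ 0)
    (hanti : ∀ a b : A, σ (a * b) = σ b * σ a) (hone_fixed : σ 1 = 1)
    (htrace : ∀ a : A, ∃ c : F, a + σ a = c • (1 : A)) {B : Submodule F A} (hone : (1 : A) ∈ B)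
    (hmul : ∀ x ∈ B, ∀ y ∈ B, x * y ∈ B) (hB : Module.finrank F B = 3) {x y : A} (hx : x ∈ B)
    (hy : y ∈ B) (hxy : x * y ≠ y * x) :
    ∃ z ∈ B, ∃ w ∈ B, σ z = -z ∧ σ w = -w ∧ w ≠ 0 ∧ z * w - w * z = (2 : F) • w := by
  have hskew : ∀ a ∈ B, ∃ c : F, a - c • (1 : A) ∈ B ∧ σ (a - c • (1 : A)) = -(a - c • (1 : A)) :=
    fun a ha => by
      obtain ⟨t, ht⟩ := htrace a
      refine ⟨t / 2, B.sub_mem ha (B.smul_mem _ hone), ?_⟩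
      have h2 : t • (1 : A) = (t / 2) • (1 : A) + (t / 2) • (1 : A) := by
        rw [← add_smul, ← mul_two, div_mul_cancel₀ _ hchar]
      rw [map_sub, map_smul, hone_fixed, eq_sub_of_add_eq' ht, h2]
      abel
  obtain ⟨s, hu, hσu⟩ := hskew x hx
  obtain ⟨t, hv, hσv⟩ := hskew y hy
  have huv : (x - s • (1 : A)) * (y - t • (1 : A)) - (y - t • (1 : A)) * (x - s • (1 : A)) =
      x * y - y * x := by
    simp only [mul_sub, sub_mul, mul_smul_comm, smul_mul_assoc, mul_one, one_mul]
    module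
  set u := x - s • (1 : A)
  set v := y - t • (1 : A)
  have hne : u * v - v * u ≠ 0 := by
    rw [huv]
    exact sub_ne_zero.mpr hxy
  have hwB : u * v - v * u ∈ B := B.sub_mem (hmul u hu v hv) (hmul v hv u hu)
  have hσw : σ (u * v - v * u) = -(u * v - v * u) := by
    rw [map_sub, hanti, hanti, hσu, hσv]
    noncomm_ring
  obtain ⟨b, hb0, hb1, hb2⟩ := exists_basis_of_not_commute hone hB hu hv (sub_ne_zero.mp hne)
  obtain ⟨c, hc⟩ : ∃ c : Fin 3 → F, u * v - v * u = c 0 • (1 : A) + c 1 • u + c 2 • v := by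
    refine ⟨b.repr ⟨_, hwB⟩, ?_⟩
    have h := b.sum_repr ⟨_, hwB⟩
    rw [Fin.sum_univ_three] at h
    simpa only [Submodule.coe_add, Submodule.coe_smul, hb0, hb1, hb2] using
      (congrArg Subtype.val h).symm
  have hc0 : c 0 • (1 : A) = 0 := by
    have h := hσw
    rw [hc] at h
    simp only [map_add, map_smul, hone_fixed, hσu, hσv] at h
    have h2 : (2 : F) • c 0 • (1 : A) = 0 := by
      linear_combination (norm := module) h
    exact (smul_eq_zero.mp h2).resolve_left hchar
  rw [hc0, zero_add] at hc
  obtain ⟨z, hz, hzw⟩ := exists_commutator_eq_two_smul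
    (W := B ⊓ LinearMap.ker (σ + LinearMap.id)) (x := u) (y := v)
    ⟨hu, by simp [hσu]⟩ ⟨hv, by simp [hσv]⟩ hne hc
  exact ⟨z, hz.1, _, hwB, eq_neg_of_add_eq_zero_left (by simpa using hz.2), hσw, hne, hzw⟩

end NonAssocAlgebra

/-- Over a field of characteristic ≠ 2, an involutive algebra is von-Neumann finite
if and only if every 3-dimensional subalgebra is commutative or isomorphic, as an
algebra, to the algebra `U` of upper triangular 2×2 matrices. -/
theorem involutive_vonNeumannFinite_iff_three_dim_subalgebras_comm_or_iso_U
    (F : Type*) [Field F] (A : Type*) [NonAssocRing A] [Module F A]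
    [SMulCommClass F A A] [IsScalarTower F A A]
    (hchar : (2 : F) ≠ 0)
    (σ : A →ₗ[F] A)
    (hanti : ∀ a b : A, σ (a * b) = σ b * σ a)
    (hinvol : ∀ a : A, σ (σ a) = a)
    (htrace : ∀ a : A, ∃ c : F, a + σ a = c • (1 : A))
    (hnorm : ∀ a : A, ∃ c : F, a * σ a = c • (1 : A)) :
    (∀ a b : A, a * b = 1 → b * a = 1) ↔
      (∀ B : Submodule F A, ∀ hone : (1 : A) ∈ B,
        ∀ hmul : (∀ x ∈ B, ∀ y ∈ B, x * y ∈ B), Module.finrank F B = 3 →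
        ((∀ x ∈ B, ∀ y ∈ B, x * y = y * x) ∨
          (∃ f : B →ₗ[F] Matrix (Fin 2) (Fin 2) F,
            Function.Injective f ∧
            Set.range f = {M : Matrix (Fin 2) (Fin 2) F | M 1 0 = 0} ∧
            f ⟨1, hone⟩ = 1 ∧
            ∀ x y : B, f ⟨(x : A) * (y : A), hmul x x.2 y y.2⟩ = f x * f y))) := by
  have hone_fixed : σ 1 = 1 := by
    have h := hanti 1 (σ 1)
    rwa [one_mul, hinvol, one_mul, eq_comm] at h
  constructor
  · intro hfin B hone hmul hB
    refine or_iff_not_imp_left.mpr fun hcomm => ?_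
    push Not at hcomm
    obtain ⟨x, hx, y, hy, hxy⟩ := hcomm
    obtain ⟨z, hz, w, hw, hσz, hσw, hw0, hzw⟩ :=
      exists_skew_pair hchar hanti hone_fixed htrace hone hmul hB hx hy hxy
    have hsq : ∀ a : A, σ a = -a → ∃ c : F, a * a = c • (1 : A) := fun a ha => by
      obtain ⟨c, hc⟩ := hnorm a
      refine ⟨-c, ?_⟩
      rw [neg_smul, ← hc, ha, mul_neg, neg_neg]
    obtain ⟨p, hp⟩ := hsq z hσz
    obtain ⟨r, hr⟩ := hsq w hσw
    obtain ⟨t, ht⟩ := htrace (z * w)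
    rw [hanti, hσz, hσw, neg_mul_neg] at ht
    have h2 : ∀ a b : A, (2 : F) • a = (2 : F) • b → a = b :=
      fun a b h => smul_right_injective A hchar h
    have hq : (2 : F) • (t / 2) • (1 : A) = t • (1 : A) := by
      rw [smul_smul, mul_div_cancel₀ _ hchar]
    have hzw' : z * w = (t / 2) • (1 : A) + w := h2 _ _ <| by
      linear_combination (norm := module) ht + hzw - hq
    have hwz' : w * z = (t / 2) • (1 : A) - w := h2 _ _ <| by
      linear_combination (norm := module) ht - hzw - hq
    obtain ⟨hp1, hq0, hr0⟩ :=
      structure_constants_of_vonNeumannFinite hchar hfin hw0 hp hzw' hwz' hr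
    rw [hp1, one_smul] at hp
    rw [hq0, zero_smul] at hzw' hwz'
    rw [hr0, zero_smul] at hr
    have hne : z * w ≠ w * z := sub_ne_zero.mp (hzw ▸ smul_ne_zero hchar hw0)
    obtain ⟨b, hb0, hb1, hb2⟩ := exists_basis_of_not_commute hone hB hz hw hne
    exact exists_iso_upperTriangular hchar hone hmul b hb0 hb1 hb2 hp (by simpa using hzw')
      (by simpa using hwz') hr
  · intro hsub a b hab
    by_contra hba
    have hne : a * b ≠ b * a := fun h => hba (h ▸ hab)
    have hquad : ∀ c : A, ∃ t n : F, c * c = t • c + n • (1 : A) := fun c => by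
      obtain ⟨t, ht⟩ := htrace c
      obtain ⟨n, hn⟩ := hnorm c
      rw [eq_sub_of_add_eq' ht, mul_sub, mul_smul_comm, mul_one] at hn
      refine ⟨t, -n, ?_⟩
      rw [neg_smul, ← hn]
      abel
    have hmem : ∀ i, ![(1 : A), a, b] i ∈ Submodule.span F (Set.range ![(1 : A), a, b]) :=
      fun i => Submodule.subset_span ⟨i, rfl⟩
    have hrank := finrank_span_eq_card (linearIndependent_one_pair_of_not_commute (F := F) hne)
    rcases hsub _ (hmem 0) (mul_mem_span_of_mul_eq_one hquad hab)
      (hrank.trans (Fintype.card_fin 3)) with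
      hcomm | ⟨f, hinj, -, hf1, hfmul⟩
    · exact hne (hcomm a (hmem 1) b (hmem 2))
    · have h := hfmul ⟨a, hmem 1⟩ ⟨b, hmem 2⟩
      have h' := hfmul ⟨b, hmem 2⟩ ⟨a, hmem 1⟩
      simp only [hab] at h
      rw [mul_eq_one_comm.mp (h.symm.trans hf1), ← hf1] at h'
      exact hba (congrArg Subtype.val (hinj h'))
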